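/- Let n be odd and z_1 < z_2 < ... < z_n be strictly increasing real numbers with median m = z_{(n+1)/2}. For any δ > 0 with δ < min(m - z_{(n-1)/2}, z_{(n+3)/2} - m), if real numbers x_1, ..., x_n satisfy |x_i - c| ≤ δ for all i and the sum over i of sign(z_i - x_i) = 0, then c ∈ [m - δ, m + δ]. -/

import Mathlib

lemma sum_neg_aux (n : ℕ) (hodd : Odd n) (f : Fin n → ℝ) (h1 : ∀ i, f i ≤ 1)
    (h2 : ∀ i : Fin n, i.val ≤ n / 2 → f i = -1) : ∑ i, f i < 0 := by
  obtain ⟨k, hk⟩ := hodd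
  have e : ∑ i, f (Fin.rev i) = ∑ i, f i := Equiv.sum_comp Fin.revPerm f
  have key : ∑ i, (f i + f (Fin.rev i)) < ∑ i : Fin n, (0 : ℝ) := by
    apply Finset.sum_lt_sum
    · intro i _
      by_cases hi : i.val ≤ n / 2
      · have := h2 i hi
        have := h1 (Fin.rev i)
        linarith
      · have := h2 (Fin.rev i) (by rw [Fin.val_rev]; omega)
        have := h1 i
        linarith
    · refine ⟨⟨n / 2, by omega⟩, Finset.mem_univ _, ?_⟩
      have a := h2 ⟨n / 2, by omega⟩ le_rfl
      have b := h2 (Fin.rev ⟨n / 2, by omega⟩) (by rw [Fin.val_rev]; simp only; omega)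
      rw [a, b]; norm_num
  rw [Finset.sum_add_distrib, e, Finset.sum_const_zero] at key
  linarith

lemma sign_bounds_aux (r : ℝ) : Real.sign r ≤ 1 ∧ -1 ≤ Real.sign r := by
  rcases Real.sign_apply_eq r with h | h | h <;> rw [h] <;> norm_num

/-- Approximate consensus values satisfying the balanced-sign condition lie
within `δ` of the median of strictly increasing reference values `z`. -/
theorem stmt_2 (n : ℕ) (hodd : Odd n) (h3 : 3 ≤ n) (z : Fin n → ℝ) (hz : StrictMono z)
    (δ c : ℝ) (hδ : 0 < δ)
    (hδ' : δ < min (z ⟨n / 2, by omega⟩ - z ⟨n / 2 - 1, by omega⟩)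
                   (z ⟨n / 2 + 1, by omega⟩ - z ⟨n / 2, by omega⟩))
    (x : Fin n → ℝ) (hx : ∀ i, |x i - c| ≤ δ)
    (hsum : ∑ i, Real.sign (z i - x i) = 0) :
    c ∈ Set.Icc (z ⟨n / 2, by omega⟩ - δ) (z ⟨n / 2, by omega⟩ + δ) := by
  constructor
  · by_contra hc
    push Not at hc
    have := sum_neg_aux n hodd (fun i => - Real.sign (z (Fin.rev i) - x (Fin.rev i)))
      (fun i => by have := (sign_bounds_aux (z (Fin.rev i) - x (Fin.rev i))).2; linarith)
      (fun i hi => by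
        have hm : z ⟨n / 2, by omega⟩ ≤ z (Fin.rev i) := by
          apply hz.monotone
          rw [Fin.le_def, Fin.val_rev]
          obtain ⟨k, hk⟩ := hodd
          simp only
          omega
        have := abs_le.1 (hx (Fin.rev i))
        rw [Real.sign_of_pos (by linarith [this.2])])
    have e : ∑ i, -Real.sign (z (Fin.rev i) - x (Fin.rev i)) = ∑ i, -Real.sign (z i - x i) :=
      Equiv.sum_comp Fin.revPerm (fun i => -Real.sign (z i - x i))
    rw [e, Finset.sum_neg_distrib, hsum] at this
    linarith
  · by_contra hc
    push Not at hc
    have := sum_neg_aux n hodd (fun i => Real.sign (z i - x i))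
      (fun i => (sign_bounds_aux _).1)
      (fun i hi => by
        have hm : z i ≤ z ⟨n / 2, by omega⟩ := hz.monotone (Fin.le_def.2 hi)
        have := abs_le.1 (hx i)
        exact Real.sign_of_neg (by linarith [this.1]))
    rw [hsum] at this
    linarith
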